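/- Let α, β be real numbers with α ≠ 0 and let r be a positive real number. Then there is no complex number u satisfying both β(u − ū) = −2iαr² and u(3α² + β²) = ū(β² − α²). -/

import Mathlib

open Complex ComplexConjugate

theorem inoue_sm_no_almost_kahler
    (α β : ℝ) (hα : α ≠ 0) (r : ℝ) (hr : 0 < r) :
    ¬ ∃ u : ℂ,
      (β : ℂ) * (u - conj u) = -2 * I * (α : ℂ) * (r : ℂ) ^ 2 ∧
      u * (3 * (α : ℂ) ^ 2 + (β : ℂ) ^ 2) = conj u * ((β : ℂ) ^ 2 - (α : ℂ) ^ 2) := by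
  rintro ⟨u, h₁, h₂⟩
  have h₁_im : β * (u.im + u.im) = -2 * α * r ^ 2 := by
    simpa [pow_two] using congrArg Complex.im h₁
  have h₂_im : u.im * (3 * α ^ 2 + β ^ 2) = -u.im * (β ^ 2 - α ^ 2) := by
    simpa [pow_two] using congrArg Complex.im h₂
  have h_pos : 0 < α ^ 2 + β ^ 2 := by positivity
  have h_mul : u.im * (α ^ 2 + β ^ 2) = 0 := by linarith
  have h_im : u.im = 0 := (mul_eq_zero.mp h_mul).resolve_right h_pos.ne'
  have h_ne : α * r ^ 2 ≠ 0 := mul_ne_zero hα (pow_ne_zero 2 hr.ne')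
  apply h_ne
  rw [h_im] at h₁_im
  linarith
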